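/- Let w ∈ E⁺ have a minimal r-factorisation w = p₁⋯pₘ, and let w′ ∈ E⁺ satisfy w′ ≡ w. Then w′ has a minimal r-factorisation w′ = p₁′⋯pₘ′ with (p₁,…,pₘ) ≈ (p₁′,…,pₘ′), and for each 1 ≤ i ≤ m either p̄ᵢ 𝓡 p̄ᵢ′ or p̄ᵢ 𝓛 p̄ᵢ′ in IG(E) (so in particular p̄ᵢ 𝓓 p̄ᵢ′); moreover p̄₁ 𝓡 p̄₁′ and p̄ₘ 𝓛 p̄ₘ′. -/

import Mathlib

section Green

variable {T : Type*} [Semigroup T]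

/-- Green's relation 𝓡. -/
def GreenR (a b : T) : Prop := a = b ∨ ∃ x y : T, a * x = b ∧ b * y = a

/-- Green's relation 𝓛. -/
def GreenL (a b : T) : Prop := a = b ∨ ∃ x y : T, x * a = b ∧ y * b = a

/-- Green's relation 𝓓 = 𝓡 ∘ 𝓛. -/
def GreenD (a b : T) : Prop := ∃ c : T, GreenR a c ∧ GreenL c b

/-- An element is regular if `a = a * b * a` for some `b`. -/
def IsRegularElem (a : T) : Prop := ∃ b : T, a * b * a = a

/-- The principal two-sided ideal `T¹ a T¹`. -/
def principalIdeal (a : T) : Set T :=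
  {x | x = a ∨ (∃ u, u * a = x) ∨ (∃ v, a * v = x) ∨ ∃ u v, u * a * v = x}

/-- Green's relation 𝓙. -/
def GreenJ (a b : T) : Prop := principalIdeal a = principalIdeal b

/-- The 𝓙-preorder. -/
def JleRel (a b : T) : Prop := principalIdeal a ⊆ principalIdeal b

/-- Strict 𝓙-order. -/
def JltRel (a b : T) : Prop := JleRel a b ∧ ¬ JleRel b a

/-- `u` is a (two-sided) identity element. -/
def IsIdentityElem (u : T) : Prop := ∀ x : T, u * x = x ∧ x * u = x

/-- The relation 𝓡̃. -/
def RTilde (a b : T) : Prop := ∀ ε : T, ε * ε = ε → (ε * a = a ↔ ε * b = b)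

/-- The relation 𝓛̃. -/
def LTilde (a b : T) : Prop := ∀ ε : T, ε * ε = ε → (a * ε = a ↔ b * ε = b)

/-- `blockProd p i k = p i * p (i+1) * ⋯ * p (i+k)`. -/
def blockProd (p : ℕ → T) (i : ℕ) : ℕ → T
  | 0 => p i
  | k + 1 => blockProd p i k * p (i + (k + 1))

/-- Multiply `x` by optional (possibly empty) words on both sides. -/
def withCtx (u : Option T) (x : T) (v : Option T) : T :=
  match u, v with
  | none, none => x
  | some u', none => u' * x
  | none, some v' => x * v'
  | some u', some v' => u' * x * v'

/-- Multiply by an optional word on the left. -/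
def leftCtx (u : Option T) (x : T) : T := match u with | none => x | some u' => u' * x

/-- Multiply by an optional word on the right. -/
def rightCtx (x : T) (v : Option T) : T := match v with | none => x | some v' => x * v'

end Green

section IGdef

/-- The set of idempotents of `S`. -/
abbrev IdemE (S : Type*) [Semigroup S] : Type _ := {x : S // x * x = x}

variable {S : Type*} [Semigroup S]

/-- `e, f` form a basic pair if `{e,f} ∩ {ef,fe} ≠ ∅`. -/
def BasicPair (e f : IdemE S) : Prop :=
  (e : S) * f = e ∨ (e : S) * f = f ∨ (f : S) * e = e ∨ (f : S) * e = f

/-- The defining relations of IG(E): `ef = g` whenever `e, f` is a basic pair with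
product `g` in `S`. -/
def igRelBase (u v : FreeSemigroup (IdemE S)) : Prop :=
  ∃ e f g : IdemE S, BasicPair e f ∧ (g : S) = (e : S) * (f : S) ∧
    u = FreeSemigroup.of e * FreeSemigroup.of f ∧ v = FreeSemigroup.of g

/-- The congruence on the free semigroup `E⁺` generated by the defining relations. -/
def igCon (S : Type*) [Semigroup S] : Con (FreeSemigroup (IdemE S)) :=
  conGen (fun u v => igRelBase u v)

/-- The free idempotent generated semigroup IG(E). -/
abbrev IG (S : Type*) [Semigroup S] := (igCon S).Quotient

/-- `w̄`, the image of a word `w ∈ E⁺` in IG(E). -/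
def igBar (w : FreeSemigroup (IdemE S)) : IG S := (w : (igCon S).Quotient)

/-- The list of letters of a word. -/
def wordList (w : FreeSemigroup (IdemE S)) : List (IdemE S) := w.head :: w.tail

/-- The length of a word. -/
def wlen (w : FreeSemigroup (IdemE S)) : ℕ := (wordList w).length

/-- Length of an optional word. -/
def olen (u : Option (FreeSemigroup (IdemE S))) : ℕ :=
  match u with | none => 0 | some u' => wlen u'

/-- `p 1, …, p m` is an r-factorisation of `w`: each factor represents a regular
element of IG(E). -/
def IsRFact (w : FreeSemigroup (IdemE S)) (m : ℕ) (p : ℕ → FreeSemigroup (IdemE S)) : Prop :=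
  1 ≤ m ∧ blockProd p 1 (m - 1) = w ∧ ∀ i, 1 ≤ i → i ≤ m → IsRegularElem (igBar (p i))

/-- A minimal r-factorisation: no product of two or more consecutive factors is regular. -/
def IsMinRFact (w : FreeSemigroup (IdemE S)) (m : ℕ) (p : ℕ → FreeSemigroup (IdemE S)) : Prop :=
  IsRFact w m p ∧
    ∀ i j, 1 ≤ i → i < j → j ≤ m → ¬ IsRegularElem (igBar (blockProd p i (j - i)))

/-- The relation ≈ on m-tuples of words. -/
def TupleApprox (m : ℕ) (p q : ℕ → FreeSemigroup (IdemE S)) : Prop :=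
  (∃ i, 1 ≤ i ∧ i ≤ m ∧ igBar (p i) = igBar (q i) ∧
    ∀ j, 1 ≤ j → j ≤ m → j ≠ i → p j = q j) ∨
  (∃ i, ∃ e : IdemE S, 1 ≤ i ∧ i < m ∧
    igBar (p i) = igBar (q i * FreeSemigroup.of e) ∧
    igBar (q (i + 1)) = igBar (FreeSemigroup.of e * p (i + 1)) ∧
    ∀ j, 1 ≤ j → j ≤ m → j ≠ i → j ≠ i + 1 → p j = q j) ∨
  (∃ i, ∃ e : IdemE S, 1 ≤ i ∧ i < m ∧
    igBar (q i) = igBar (p i * FreeSemigroup.of e) ∧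
    igBar (p (i + 1)) = igBar (FreeSemigroup.of e * q (i + 1)) ∧
    ∀ j, 1 ≤ j → j ≤ m → j ≠ i → j ≠ i + 1 → p j = q j)

/-- The relation ∼: the transitive closure of ≈. -/
def TupleSim (m : ℕ) (p q : ℕ → FreeSemigroup (IdemE S)) : Prop :=
  Relation.TransGen (TupleApprox m) p q

/-- One application of a defining relation of IG(E) inside a word. -/
def RewriteStep (w w' : FreeSemigroup (IdemE S)) : Prop :=
  ∃ (u v : Option (FreeSemigroup (IdemE S))) (x y : FreeSemigroup (IdemE S)),
    (igRelBase x y ∨ igRelBase y x) ∧ w = withCtx u x v ∧ w' = withCtx u y v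

/-- `e` is a seed of `w` at (1-based) position `k`. -/
def SeedAt (w : FreeSemigroup (IdemE S)) (e : IdemE S) (k : ℕ) : Prop :=
  ∃ u v : Option (FreeSemigroup (IdemE S)),
    w = withCtx u (FreeSemigroup.of e) v ∧ k = olen u + 1 ∧
    GreenL (igBar (leftCtx u (FreeSemigroup.of e))) (igBar (FreeSemigroup.of e)) ∧
    GreenR (igBar (FreeSemigroup.of e)) (igBar (rightCtx (FreeSemigroup.of e) v))

/-- The coordinate (position within `w` of the first letter) of the `i`-th factor. -/
def wcoord (p : ℕ → FreeSemigroup (IdemE S)) (i : ℕ) : ℕ :=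
  1 + ∑ j ∈ Finset.Ico 1 i, wlen (p j)

end IGdef

section Words

lemma append_eq_append_cons_cases {α : Type*} {l l' x y : List α} {s : α}
    (h : l ++ l' = x ++ s :: y) :
    (∃ t, x = l ++ t ∧ l' = t ++ s :: y) ∨ ∃ t, l = x ++ s :: t ∧ y = t ++ l' := by
  rcases List.append_eq_append_iff.1 h with h | ⟨_ | ⟨b, t⟩, rfl, ht⟩
  · exact Or.inl h
  · exact Or.inl ⟨[], by simp, by simpa using ht.symm⟩
  · obtain ⟨rfl, rfl⟩ : s = b ∧ y = t ++ l' := by simpa using ht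
    exact Or.inr ⟨t, rfl, rfl⟩

variable {S : Type*} [Semigroup S]

/-- The image of a letter in the monoid obtained from IG(E) by adjoining an identity. -/
def letterBar (e : IdemE S) : WithOne (IG S) := (igBar (FreeSemigroup.of e) : IG S)

/-- The image of a possibly empty word in the monoid obtained from IG(E) by adjoining an
identity. -/
def listBar (l : List (IdemE S)) : WithOne (IG S) := (l.map letterBar).prod

@[simp] lemma listBar_nil : listBar ([] : List (IdemE S)) = 1 := rfl

@[simp] lemma listBar_cons (e : IdemE S) (l : List (IdemE S)) :
    listBar (e :: l) = letterBar e * listBar l := by simp [listBar]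

@[simp] lemma listBar_append (l l' : List (IdemE S)) :
    listBar (l ++ l') = listBar l * listBar l' := by simp [listBar]

lemma listBar_flatten_replicate (n : ℕ) (l : List (IdemE S)) :
    listBar (List.replicate n l).flatten = listBar l ^ n := by
  induction n with
  | zero => simp
  | succ n ih => simp [List.replicate_succ, ih, pow_succ']

@[simp] lemma wordList_of (e : IdemE S) : wordList (FreeSemigroup.of e) = [e] := rfl

@[simp] lemma wordList_mul (u v : FreeSemigroup (IdemE S)) :
    wordList (u * v) = wordList u ++ wordList v := by
  simp [wordList]

lemma wordList_injective : Function.Injective (wordList (S := S)) := by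
  rintro ⟨a, l⟩ ⟨b, l'⟩ h
  simpa [wordList] using h

lemma wordList_ne_nil (u : FreeSemigroup (IdemE S)) : wordList u ≠ [] := by simp [wordList]

lemma exists_wordList_eq {l : List (IdemE S)} (h : l ≠ []) :
    ∃ u : FreeSemigroup (IdemE S), wordList u = l := by
  cases l with
  | nil => exact absurd rfl h
  | cons a l => exact ⟨⟨a, l⟩, rfl⟩

lemma igBar_mul (u v : FreeSemigroup (IdemE S)) : igBar (u * v) = igBar u * igBar v := rfl

lemma listBar_wordList (u : FreeSemigroup (IdemE S)) :
    listBar (wordList u) = ((igBar u : IG S) : WithOne (IG S)) := by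
  induction u using FreeSemigroup.recOnMul with
  | ih1 e => simp [letterBar]
  | ih2 e u _ hu => simp [hu, letterBar, igBar_mul, WithOne.coe_mul]

lemma igBar_eq_iff (u v : FreeSemigroup (IdemE S)) :
    igBar u = igBar v ↔ listBar (wordList u) = listBar (wordList v) := by
  rw [listBar_wordList, listBar_wordList, WithOne.coe_inj]

lemma letterBar_mul {e f g : IdemE S} (h : BasicPair e f) (hg : (g : S) = e * f) :
    letterBar e * letterBar f = letterBar g := by
  have : igBar (FreeSemigroup.of e * FreeSemigroup.of f) = igBar (FreeSemigroup.of g) :=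
    (Con.eq _).2 (ConGen.Rel.of _ _ ⟨e, f, g, h, hg, rfl, rfl⟩)
  rw [igBar_eq_iff] at this
  simpa using this

@[simp] lemma letterBar_mul_self (e : IdemE S) : letterBar e * letterBar e = letterBar e :=
  letterBar_mul (Or.inl e.2) e.2.symm

lemma letterBar_basicPair {e f g : IdemE S} (h : BasicPair e f) (hg : (g : S) = e * f) :
    letterBar g * letterBar e = letterBar e ∨ letterBar f * letterBar g = letterBar f := by
  have he := e.2
  have hf := f.2
  rcases h with h | h | h | h
  · obtain rfl : g = e := Subtype.ext (hg.trans h)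
    simp
  · obtain rfl : g = f := Subtype.ext (hg.trans h)
    simp
  · have : (g : S) * e = e := by rw [hg, mul_assoc, h, he]
    exact Or.inl (letterBar_mul (Or.inr (Or.inl this)) this.symm)
  · have : (f : S) * g = f := by rw [hg, ← mul_assoc, h, hf]
    exact Or.inr (letterBar_mul (Or.inl this) this.symm)

/-- `l'` arises from `l` by contracting a basic pair of adjacent letters to its product. -/
def Contracts (l l' : List (IdemE S)) : Prop :=
  ∃ (u v : List (IdemE S)) (e f g : IdemE S), BasicPair e f ∧ (g : S) = e * f ∧
    l = u ++ e :: f :: v ∧ l' = u ++ g :: v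

lemma iff_of_igBar_eq {Q : List (IdemE S) → Prop} (hQ : ∀ l l', Contracts l l' → (Q l ↔ Q l'))
    {u v : FreeSemigroup (IdemE S)} (h : igBar u = igBar v) :
    Q (wordList u) ↔ Q (wordList v) := by
  have key : ∀ a b, ConGen.Rel (fun u v => igRelBase (S := S) u v) a b →
      ∀ x y, Q (x ++ wordList a ++ y) ↔ Q (x ++ wordList b ++ y) := by
    intro a b hab
    induction hab with
    | of a b h =>
      obtain ⟨e, f, g, hef, hg, rfl, rfl⟩ := h
      exact fun x y => hQ _ _ ⟨x, y, e, f, g, hef, hg, by simp, by simp⟩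
    | refl a => exact fun _ _ => Iff.rfl
    | symm _ ih => exact fun x y => (ih x y).symm
    | trans _ _ ih ih' => exact fun x y => (ih x y).trans (ih' x y)
    | mul _ _ ih ih' =>
      rename_i a b c d _ _
      intro x y
      have h1 := ih x (wordList c ++ y)
      have h2 := ih' (x ++ wordList b) y
      simp only [wordList_mul, List.append_assoc] at h1 h2 ⊢
      exact h1.trans h2
  simpa using key u v ((Con.eq _).1 h) [] []

/-- A word `l` has a seed: a letter `s` with `l = x s y` such that `x s 𝓛 s 𝓡 s y`. -/
def Seeded (l : List (IdemE S)) : Prop :=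
  ∃ (x : List (IdemE S)) (s : IdemE S) (y : List (IdemE S)), l = x ++ s :: y ∧
    (∃ a, a * listBar x * letterBar s = letterBar s) ∧
    ∃ c, letterBar s * listBar y * c = letterBar s

lemma Seeded.ne_nil {l : List (IdemE S)} (h : Seeded l) : l ≠ [] := by
  obtain ⟨x, s, y, rfl, -⟩ := h
  simp

lemma seeded_singleton (e : IdemE S) : Seeded [e] :=
  ⟨[], e, [], rfl, ⟨1, by simp⟩, ⟨1, by simp⟩⟩

lemma Seeded.append_right {l t : List (IdemE S)} (h : Seeded l) {c : WithOne (IG S)}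
    (hc : listBar l * listBar t * c = listBar l) : Seeded (l ++ t) := by
  obtain ⟨x, s, y, rfl, ⟨a, ha⟩, d, hd⟩ := h
  refine ⟨x, s, y ++ t, by simp, ⟨a, ha⟩, c * d, ?_⟩
  have h1 : letterBar s * listBar y = a * listBar (x ++ s :: y) := by
    simp only [listBar_append, listBar_cons, ← mul_assoc, ha]
  calc letterBar s * listBar (y ++ t) * (c * d)
      = letterBar s * listBar y * listBar t * c * d := by simp [mul_assoc]
    _ = a * (listBar (x ++ s :: y) * listBar t * c) * d := by rw [h1]; simp only [mul_assoc]
    _ = letterBar s := by rw [hc, ← h1, hd]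

lemma Seeded.append_left {l t : List (IdemE S)} (h : Seeded l) {c : WithOne (IG S)}
    (hc : c * listBar t * listBar l = listBar l) : Seeded (t ++ l) := by
  obtain ⟨x, s, y, rfl, ⟨a, ha⟩, d, hd⟩ := h
  refine ⟨t ++ x, s, y, by simp, ⟨a * c, ?_⟩, d, hd⟩
  have h1 : listBar x * letterBar s = listBar (x ++ s :: y) * d := by
    simp only [listBar_append, listBar_cons, mul_assoc]
    rw [← mul_assoc (letterBar s), hd]
  calc a * c * listBar (t ++ x) * letterBar s
      = a * (c * listBar t * (listBar x * letterBar s)) := by simp [mul_assoc]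
    _ = a * (c * listBar t * listBar (x ++ s :: y) * d) := by rw [h1]; simp only [mul_assoc]
    _ = letterBar s := by rw [hc, ← h1, ← mul_assoc, ha]

lemma seeded_iff_of_contracts {l l' : List (IdemE S)} (h : Contracts l l') :
    Seeded l ↔ Seeded l' := by
  obtain ⟨u, v, e, f, g, hef, hg, rfl, rfl⟩ := h
  have hm := letterBar_mul hef hg
  constructor
  · rintro ⟨x, s, y, hxy, ⟨a, ha⟩, c, hc⟩
    rcases append_eq_append_cons_cases hxy with ⟨z, rfl, hz⟩ | ⟨z, rfl, rfl⟩
    · rcases z with _ | ⟨b, _ | ⟨b', z⟩⟩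
      · obtain ⟨rfl, rfl⟩ : e = s ∧ f :: v = y := by simpa using hz
        refine ⟨u, g, v, rfl, ⟨a, ?_⟩, c * letterBar f, ?_⟩
        · rw [← hm, ← mul_assoc]
          simp only [List.append_nil] at ha
          rw [ha]
        · rw [← hm]
          rw [listBar_cons, ← mul_assoc] at hc
          rw [← mul_assoc, hc]
      · obtain ⟨rfl, rfl, rfl⟩ : e = b ∧ f = s ∧ v = y := by simpa using hz
        refine ⟨u, g, v, rfl, ⟨letterBar e * a, ?_⟩, c, ?_⟩
        · rw [← hm]
          simp only [listBar_append, listBar_cons, listBar_nil, mul_one, mul_assoc] at ha ⊢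
          rw [ha]
        · rw [← hm, mul_assoc, mul_assoc, ← mul_assoc (letterBar f), hc]
      · obtain ⟨rfl, rfl, rfl⟩ : e = b ∧ f = b' ∧ v = z ++ s :: y := by simpa using hz
        refine ⟨u ++ g :: z, s, y, by simp, ⟨a, ?_⟩, c, hc⟩
        refine Eq.trans ?_ ha
        simp [← hm, mul_assoc]
    · refine ⟨x, s, z ++ g :: v, by simp, ⟨a, ha⟩, c, ?_⟩
      refine Eq.trans ?_ hc
      simp [← hm, mul_assoc]
  · rintro ⟨x, s, y, hxy, ⟨a, ha⟩, c, hc⟩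
    rcases append_eq_append_cons_cases hxy with ⟨z, rfl, hz⟩ | ⟨z, rfl, rfl⟩
    · rcases z with _ | ⟨b, z⟩
      · obtain ⟨rfl, rfl⟩ : g = s ∧ v = y := by simpa using hz
        simp only [List.append_nil] at ha
        rcases letterBar_basicPair hef hg with h | h
        · refine ⟨u, e, f :: v, rfl, ⟨a, ?_⟩, c * letterBar e, ?_⟩
          · rw [← h, ← mul_assoc, ha]
          · rw [listBar_cons, ← mul_assoc, ← mul_assoc, hm, hc, h]
        · refine ⟨u ++ [e], f, v, by simp, ⟨letterBar f * a, ?_⟩, c, ?_⟩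
          · rw [listBar_append, listBar_cons, listBar_nil, mul_one, ← mul_assoc, mul_assoc, hm,
              mul_assoc, mul_assoc, ← mul_assoc a, ha, h]
          · rw [← h]
            simp only [mul_assoc] at hc ⊢
            rw [hc]
      · obtain ⟨rfl, rfl⟩ : g = b ∧ v = z ++ s :: y := by simpa using hz
        refine ⟨u ++ e :: f :: z, s, y, by simp, ⟨a, ?_⟩, c, hc⟩
        refine Eq.trans ?_ ha
        simp [← hm, mul_assoc]
    · refine ⟨x, s, z ++ e :: f :: v, by simp, ⟨a, ha⟩, c, ?_⟩
      refine Eq.trans ?_ hc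
      simp [← hm, mul_assoc]

lemma seeded_iff_of_igBar_eq {u v : FreeSemigroup (IdemE S)} (h : igBar u = igBar v) :
    Seeded (wordList u) ↔ Seeded (wordList v) :=
  iff_of_igBar_eq (fun _ _ => seeded_iff_of_contracts) h

/-- Two elements of a monoid generate the same right ideal. -/
def RightEquiv {M : Type*} [Monoid M] (a b : M) : Prop := (∃ x, a * x = b) ∧ ∃ y, b * y = a

/-- Two elements of a monoid generate the same left ideal. -/
def LeftEquiv {M : Type*} [Monoid M] (a b : M) : Prop := (∃ x, x * a = b) ∧ ∃ y, y * b = a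

/-- Contracting a basic pair straddling the boundary of two seeded words: either the two words
merge to a seeded word, or one of them absorbs the product. -/
lemma seeded_boundary {u v : List (IdemE S)} {e f g : IdemE S} (hef : BasicPair e f)
    (hg : (g : S) = e * f) (hu : Seeded (u ++ [e])) (hv : Seeded (f :: v)) :
    Seeded (u ++ e :: f :: v) ∨
    (Seeded v ∧ Seeded (u ++ [g]) ∧ RightEquiv (listBar (u ++ [e])) (listBar (u ++ [g])) ∧
      LeftEquiv (listBar (f :: v)) (listBar v)) ∨
    (Seeded u ∧ Seeded (g :: v) ∧ RightEquiv (listBar (u ++ [e])) (listBar u) ∧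
      LeftEquiv (listBar (f :: v)) (listBar (g :: v))) := by
  have hm := letterBar_mul hef hg
  rcases letterBar_basicPair hef hg with h | h
  · have hs := hv
    obtain ⟨x, s, y, hxy, ⟨a, ha⟩, c, hc⟩ := hs
    rcases x with _ | ⟨b, x⟩
    · left
      obtain ⟨rfl, rfl⟩ : f = s ∧ v = y := by simpa using hxy
      have := hu.append_right (t := f :: v) (c := c * letterBar e) ?_
      · simpa using this
      · calc listBar (u ++ [e]) * listBar (f :: v) * (c * letterBar e)
            = listBar u * letterBar e * (letterBar f * listBar v * c) * letterBar e := by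
              simp [mul_assoc]
          _ = listBar u * ((letterBar e * letterBar f) * letterBar e) := by
              rw [hc]; simp only [mul_assoc]
          _ = _ := by rw [hm, h]; simp
    · right; left
      obtain ⟨rfl, rfl⟩ : f = b ∧ v = x ++ s :: y := by simpa using hxy
      refine ⟨⟨x, s, y, rfl, ⟨a * letterBar f, ?_⟩, c, hc⟩, ?_,
        ⟨⟨letterBar f, ?_⟩, ⟨letterBar e, ?_⟩⟩, ⟨⟨listBar x * a, ?_⟩, ⟨letterBar f, ?_⟩⟩⟩
      · simpa [mul_assoc] using ha
      · refine (seeded_iff_of_contracts (l := u ++ [e, f])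
          ⟨u, [], e, f, g, hef, hg, rfl, rfl⟩).1 ?_
        have := hu.append_right (t := [f]) (c := letterBar e) ?_
        · simpa using this
        · simp only [listBar_append, listBar_cons, listBar_nil, mul_one, mul_assoc]
          rw [← mul_assoc (letterBar e), hm, h]
      · simp [mul_assoc, hm]
      · simp [mul_assoc, h]
      · have := congrArg (fun t => listBar x * (t * listBar y)) ha
        simpa [mul_assoc] using this
      · simp
  · have hs := hu
    obtain ⟨x, s, y, hxy, ⟨a, ha⟩, c, hc⟩ := hs
    rcases List.eq_nil_or_concat y with rfl | ⟨y, b, rfl⟩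
    · left
      obtain ⟨rfl, rfl⟩ : u = x ∧ e = s := by simpa using List.append_inj' hxy rfl
      have := hv.append_left (t := u ++ [e]) (c := letterBar f * a) ?_
      · simpa using this
      · calc letterBar f * a * listBar (u ++ [e]) * listBar (f :: v)
            = letterBar f * (a * listBar u * letterBar e) * letterBar f * listBar v := by
              simp [mul_assoc]
          _ = letterBar f * (letterBar e * letterBar f) * listBar v := by
              rw [ha]; simp only [mul_assoc]
          _ = _ := by rw [hm, h]; simp
    · right; right
      obtain ⟨rfl, rfl⟩ : u = x ++ s :: y ∧ e = b := by
        have h0 : u ++ [e] = (x ++ s :: y) ++ [b] := by simpa using hxy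
        simpa using List.append_inj' h0 rfl
      refine ⟨⟨x, s, y, rfl, ⟨a, ha⟩, letterBar e * c, ?_⟩, ?_,
        ⟨⟨c * listBar y, ?_⟩, ⟨letterBar e, ?_⟩⟩, ⟨⟨letterBar e, ?_⟩, ⟨letterBar f, ?_⟩⟩⟩
      · simpa [mul_assoc] using hc
      · refine (seeded_iff_of_contracts (l := e :: f :: v)
          ⟨[], v, e, f, g, hef, hg, rfl, rfl⟩).1 ?_
        have := hv.append_left (t := [e]) (c := letterBar f) ?_
        · simpa using this
        · simp only [listBar_cons, listBar_nil, mul_one, ← mul_assoc]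
          rw [mul_assoc (letterBar f), hm, h]
      · have := congrArg (fun t => listBar x * (t * listBar y)) hc
        simpa [mul_assoc] using this
      · simp [mul_assoc]
      · simp [← mul_assoc, hm]
      · simp [← mul_assoc, h]

lemma flatten_eq_append_cons {α : Type*} {L : List (List α)} {u v : List α} {g : α}
    (h : L.flatten = u ++ g :: v) :
    ∃ L₁ u₁ v₁ L₂, L = L₁ ++ (u₁ ++ g :: v₁) :: L₂ ∧ u = L₁.flatten ++ u₁ ∧
      v = v₁ ++ L₂.flatten := by
  induction L generalizing u with
  | nil => simp at h
  | cons l L ih =>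
    rw [List.flatten_cons] at h
    rcases append_eq_append_cons_cases h with ⟨z, rfl, hz⟩ | ⟨z, rfl, rfl⟩
    · obtain ⟨L₁, u₁, v₁, L₂, rfl, rfl, rfl⟩ := ih hz
      exact ⟨l :: L₁, u₁, v₁, L₂, by simp, by simp, rfl⟩
    · exact ⟨[], u, z, L, rfl, rfl, rfl⟩

lemma flatten_eq_append_cons_cons {α : Type*} {L : List (List α)} (hL : ∀ l ∈ L, l ≠ [])
    {u v : List α} {e f : α} (h : L.flatten = u ++ e :: f :: v) :
    (∃ L₁ u₁ v₁ L₂, L = L₁ ++ (u₁ ++ e :: f :: v₁) :: L₂ ∧ u = L₁.flatten ++ u₁ ∧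
      v = v₁ ++ L₂.flatten) ∨
    ∃ L₁ u₁ v₁ L₂, L = L₁ ++ (u₁ ++ [e]) :: (f :: v₁) :: L₂ ∧ u = L₁.flatten ++ u₁ ∧
      v = v₁ ++ L₂.flatten := by
  obtain ⟨L₁, u₁, v₁, L₂, rfl, rfl, hv⟩ := flatten_eq_append_cons h
  rcases v₁ with _ | ⟨b, v₁⟩
  · rcases L₂ with _ | ⟨l, L₂⟩
    · simp at hv
    · rcases l with _ | ⟨b, l⟩
      · exact absurd rfl (hL [] (by simp))
      · obtain ⟨rfl, rfl⟩ : f = b ∧ v = l ++ L₂.flatten := by simpa using hv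
        exact Or.inr ⟨L₁, u₁, l, L₂, rfl, rfl, rfl⟩
  · obtain ⟨rfl, rfl⟩ : f = b ∧ v = v₁ ++ L₂.flatten := by simpa using hv
    exact Or.inl ⟨L₁, u₁, v₁, L₂, rfl, rfl, rfl⟩

/-- `l` is a concatenation of at most `m` seeded words. -/
def SeededFact (m : ℕ) (l : List (IdemE S)) : Prop :=
  ∃ L : List (List (IdemE S)), L.length ≤ m ∧ L.flatten = l ∧ ∀ l ∈ L, Seeded l

lemma seededFact_length (l : List (IdemE S)) : SeededFact l.length l := by
  refine ⟨l.map fun e => [e], by simp, ?_, ?_⟩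
  · induction l <;> simp_all
  · simp only [List.mem_map]
    rintro _ ⟨e, -, rfl⟩
    exact seeded_singleton e

lemma seededFact_iff_of_contracts {m : ℕ} {l l' : List (IdemE S)} (h : Contracts l l') :
    SeededFact m l ↔ SeededFact m l' := by
  obtain ⟨u, v, e, f, g, hef, hg, rfl, rfl⟩ := h
  have replace_block : ∀ {L₁ L₂ : List (List (IdemE S))} {b b'},
      (L₁ ++ b :: L₂).length ≤ m → (∀ l ∈ L₁ ++ b :: L₂, Seeded l) → (Seeded b → Seeded b') →
      SeededFact m ((L₁ ++ b' :: L₂).flatten) := by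
    intro L₁ L₂ b b' h1 h2 h3
    refine ⟨_, by simpa using h1, rfl, ?_⟩
    intro l hl
    simp only [List.mem_append, List.mem_cons] at h2 hl
    rcases hl with hl | rfl | hl
    · exact h2 l (Or.inl hl)
    · exact h3 (h2 b (Or.inr (Or.inl rfl)))
    · exact h2 l (Or.inr (Or.inr hl))
  constructor
  · rintro ⟨L, hm, hL, hs⟩
    rcases flatten_eq_append_cons_cons (fun l hl => (hs l hl).ne_nil) hL with
      ⟨L₁, u₁, v₁, L₂, rfl, rfl, rfl⟩ | ⟨L₁, u₁, v₁, L₂, rfl, rfl, rfl⟩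
    · have := replace_block (b' := u₁ ++ g :: v₁) hm hs
        (seeded_iff_of_contracts ⟨u₁, v₁, e, f, g, hef, hg, rfl, rfl⟩).1
      simpa using this
    · have hs1 : ∀ l ∈ L₁, Seeded l := fun l hl => hs l (by simp [hl])
      have hs2 : ∀ l ∈ L₂, Seeded l := fun l hl => hs l (by simp [hl])
      rcases seeded_boundary hef hg (hs (u₁ ++ [e]) (by simp)) (hs (f :: v₁) (by simp)) with
        h | ⟨h1, h2, -⟩ | ⟨h1, h2, -⟩
      · rw [seeded_iff_of_contracts ⟨u₁, v₁, e, f, g, hef, hg, rfl, rfl⟩] at h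
        refine ⟨L₁ ++ (u₁ ++ g :: v₁) :: L₂, ?_, by simp, ?_⟩
        · simp at hm ⊢; omega
        · simp only [List.mem_append, List.mem_cons]
          rintro l (hl | rfl | hl)
          exacts [hs1 l hl, h, hs2 l hl]
      · refine ⟨L₁ ++ (u₁ ++ [g]) :: v₁ :: L₂, by simpa using hm, by simp, ?_⟩
        simp only [List.mem_append, List.mem_cons (b := u₁ ++ [g]), List.mem_cons (b := v₁)]
        rintro l (hl | rfl | rfl | hl)
        exacts [hs1 l hl, h2, h1, hs2 l hl]
      · refine ⟨L₁ ++ u₁ :: (g :: v₁) :: L₂, by simpa using hm, by simp, ?_⟩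
        simp only [List.mem_append, List.mem_cons (b := u₁), List.mem_cons (b := g :: v₁)]
        rintro l (hl | rfl | rfl | hl)
        exacts [hs1 l hl, h1, h2, hs2 l hl]
  · rintro ⟨L, hm, hL, hs⟩
    obtain ⟨L₁, u₁, v₁, L₂, rfl, rfl, rfl⟩ := flatten_eq_append_cons hL
    have := replace_block (b' := u₁ ++ e :: f :: v₁) hm hs
      (seeded_iff_of_contracts ⟨u₁, v₁, e, f, g, hef, hg, rfl, rfl⟩).2
    simpa using this

lemma replicate_flatten_eq_append_cons {α : Type*} {N : ℕ} {W x y : List α} {s : α}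
    (h : (List.replicate N W).flatten = x ++ s :: y) :
    ∃ j u v, W = u ++ s :: v ∧ x = (List.replicate j W).flatten ++ u := by
  obtain ⟨L₁, u, v, L₂, hL, rfl, -⟩ := flatten_eq_append_cons h
  obtain ⟨-, h1, h2⟩ := List.append_eq_replicate_iff.1 hL.symm
  exact ⟨L₁.length, u, v, (List.eq_of_mem_replicate (h2 ▸ List.mem_cons_self)).symm,
    by rw [← h1]⟩

/-- If a power of a word is cut into fewer blocks than its exponent, some block contains a
full copy of the word. -/
lemma exists_block_of_flatten_eq {α : Type*} {W : List α} (hW : W ≠ [])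
    {L : List (List α)} {N : ℕ} (hN : L.length < N) {q r : List α} (hqr : W = q ++ r)
    (h : L.flatten = r ++ (List.replicate N W).flatten) :
    ∃ l ∈ L, ∃ q r z z' K, W = q ++ r ∧ l = r ++ W ++ z ∧
      (List.replicate K W).flatten = z ++ z' := by
  induction L generalizing N q r with
  | nil =>
    obtain ⟨N, rfl⟩ : ∃ k, N = k + 1 := ⟨N - 1, by simp at hN; omega⟩
    simp [List.replicate_succ, hW] at h
  | cons l L ih =>
    obtain ⟨N, rfl⟩ : ∃ k, N = k + 1 := ⟨N - 1, by simp at hN; omega⟩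
    simp only [List.length_cons, Nat.add_lt_add_iff_right] at hN
    have lift : (∃ l ∈ L, ∃ q r z z' K, W = q ++ r ∧ l = r ++ W ++ z ∧
        (List.replicate K W).flatten = z ++ z') →
        ∃ l' ∈ l :: L, ∃ q r z z' K, W = q ++ r ∧ l' = r ++ W ++ z ∧
        (List.replicate K W).flatten = z ++ z' :=
      fun ⟨l', hl', H⟩ => ⟨l', List.mem_cons_of_mem _ hl', H⟩
    rw [List.flatten_cons] at h
    rcases List.append_eq_append_iff.1 h with ⟨r', rfl, hr⟩ | ⟨t, rfl, ht⟩
    · exact lift (ih (N := N + 1) (by omega) (q := q ++ l) (r := r') (by simpa using hqr) hr)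
    · rw [List.replicate_succ, List.flatten_cons] at ht
      rcases List.append_eq_append_iff.1 ht with ⟨z, rfl, hz⟩ | ⟨r', hr', hr⟩
      · exact ⟨_, List.mem_cons_self, q, r, z, L.flatten, N, hqr, by simp, hz⟩
      · exact lift (ih hN hr' hr)

lemma mul_mul_mul_eq_of_right {M : Type*} [Monoid M] {U V s c : M} (hs : s * s = s)
    (hi : U * s * V * (U * s * V) = U * s * V) (hc : s * V * U * s * c = s) :
    s * V * U * s = s := by
  set z := s * V * U * s with hz
  have hzs : z * s = z := by rw [hz, mul_assoc, hs]
  have h3 : z * z * z = z * z := by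
    calc z * z * z = s * V * U * (s * s) * V * U * (s * s) * V * U * s := by
          simp only [hz, mul_assoc]
      _ = s * V * (U * s * V * (U * s * V)) * U * s := by simp only [hs, mul_assoc]
      _ = s * V * U * (s * s) * V * U * s := by rw [hi, hs]; simp only [mul_assoc]
      _ = z * z := by simp only [hz, mul_assoc]
  have h2 : z * z = z := by
    have := congrArg (· * c) h3
    simp only [mul_assoc, hc, hzs] at this
    exact this
  have := congrArg (· * c) h2
  simp only [mul_assoc, hc, hzs] at this
  exact this

lemma mul_mul_mul_eq_of_left {M : Type*} [Monoid M] {U V s a : M} (hs : s * s = s)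
    (hi : U * s * V * (U * s * V) = U * s * V) (ha : a * (s * V * U * s) = s) :
    s * V * U * s = s := by
  set z := s * V * U * s with hz
  have hsz : s * z = z := by simp only [hz, ← mul_assoc, hs]
  have h3 : z * z * z = z * z := by
    calc z * z * z = s * V * U * (s * s) * V * U * (s * s) * V * U * s := by
          simp only [hz, mul_assoc]
      _ = s * V * (U * s * V * (U * s * V)) * U * s := by simp only [hs, mul_assoc]
      _ = s * V * U * (s * s) * V * U * s := by rw [hi, hs]; simp only [mul_assoc]
      _ = z * z := by simp only [hz, mul_assoc]
  have h2 : z * z = z := by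
    have := congrArg (a * ·) h3
    simp only [← mul_assoc, ha, hsz] at this
    exact this
  have := congrArg (a * ·) h2
  simp only [← mul_assoc, ha, hsz] at this
  exact this

/-- A word representing an idempotent of IG(E) has a seed. -/
lemma seeded_of_idempotent {w : FreeSemigroup (IdemE S)} (hw : igBar w * igBar w = igBar w) :
    Seeded (wordList w) := by
  have hpow : ∀ n, ∃ u : FreeSemigroup (IdemE S), igBar u = igBar w ∧
      wordList u = (List.replicate (n + 1) (wordList w)).flatten := by
    intro n
    induction n with
    | zero => exact ⟨w, rfl, by simp⟩
    | succ n ih =>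
      obtain ⟨u, hu, hul⟩ := ih
      exact ⟨w * u, by rw [igBar_mul, hu, hw],
        by rw [wordList_mul, hul, List.replicate_succ (n := n + 1), List.flatten_cons]⟩
  have hidem : listBar (wordList w) * listBar (wordList w) = listBar (wordList w) := by
    rw [listBar_wordList, ← WithOne.coe_mul, hw]
  obtain ⟨u, hu, hul⟩ := hpow (wordList w).length
  obtain ⟨L, hLn, hLf, hLs⟩ := (iff_of_igBar_eq (fun _ _ => seededFact_iff_of_contracts) hu).2
    (seededFact_length (wordList w))
  rw [hul] at hLf
  obtain ⟨l, hl, q, r, z, z', K, hqr, rfl, hz⟩ := exists_block_of_flatten_eq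
    (wordList_ne_nil w) (Nat.lt_succ_of_le hLn) (q := wordList w) (r := []) (by simp)
    (by simpa using hLf)
  generalize wordList w = W at *
  have wrap : ∀ {U V : List (IdemE S)} {s : IdemE S}, W = U ++ s :: V →
      letterBar s * listBar V * listBar U * letterBar s = letterBar s → Seeded W := by
    intro U V s hW h
    exact ⟨U, s, V, hW, ⟨letterBar s * listBar V, h⟩, listBar U * letterBar s,
      by rw [← mul_assoc, h]⟩
  have hsplit : ∀ {U V : List (IdemE S)} {s : IdemE S}, W = U ++ s :: V →
      listBar W = listBar U * letterBar s * listBar V := by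
    rintro U V s rfl
    simp [mul_assoc]
  obtain ⟨x, s, y, hxy, ⟨a, ha⟩, c, hc⟩ := hLs _ hl
  rw [List.append_assoc] at hxy
  rcases append_eq_append_cons_cases hxy with ⟨x, rfl, ht⟩ | ⟨t, rfl, rfl⟩
  · rcases append_eq_append_cons_cases ht with ⟨t, rfl, rfl⟩ | ⟨t, hW, rfl⟩
    · obtain ⟨j, U, V, hW, rfl⟩ := replicate_flatten_eq_append_cons (y := y ++ z')
        (by simpa using hz)
      have h1 := hsplit hW
      refine wrap hW (mul_mul_mul_eq_of_left (a := a * listBar r * listBar W ^ j *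
        listBar U) (letterBar_mul_self s) (by rw [← h1, hidem]) ?_)
      refine Eq.trans ?_ ha
      simp only [listBar_append, listBar_flatten_replicate]
      calc _ = a * listBar r * (listBar W ^ j * (listBar U * letterBar s * listBar V)) *
              listBar U * letterBar s := by simp only [mul_assoc]
        _ = _ := by rw [← h1, ← pow_succ, pow_succ']; simp only [mul_assoc]
    · refine ⟨x, s, t, hW, ⟨a * listBar r, ?_⟩, listBar z * c, ?_⟩
      · simpa [mul_assoc] using ha
      · simpa [mul_assoc] using hc
  · have hW : W = (q ++ x) ++ s :: t := by simpa using hqr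
    have h1 := hsplit hW
    refine wrap hW (mul_mul_mul_eq_of_right (c := listBar t * listBar z * c)
      (letterBar_mul_self s) (by rw [← h1, hidem]) ?_)
    refine Eq.trans ?_ hc
    rw [listBar_append t, listBar_append W, h1]
    simp only [mul_assoc]

lemma isRegularElem_iff_exists (w : FreeSemigroup (IdemE S)) :
    IsRegularElem (igBar w) ↔
      ∃ d, listBar (wordList w) * d * listBar (wordList w) = listBar (wordList w) := by
  rw [listBar_wordList]
  constructor
  · rintro ⟨d, hd⟩
    exact ⟨d, by exact_mod_cast hd⟩
  · rintro ⟨d, hd⟩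
    cases d with
    | one =>
      rw [mul_one, ← WithOne.coe_mul, WithOne.coe_inj] at hd
      exact ⟨igBar w, by rw [hd, hd]⟩
    | coe d => exact ⟨d, by exact_mod_cast hd⟩

lemma isRegularElem_iff_seeded (w : FreeSemigroup (IdemE S)) :
    IsRegularElem (igBar w) ↔ Seeded (wordList w) := by
  constructor
  · rintro ⟨t, ht⟩
    obtain ⟨t, rfl⟩ : ∃ u, igBar u = t :=
      Con.induction_on t fun u => ⟨u, rfl⟩
    have hs : Seeded (wordList (w * t)) := seeded_of_idempotent (by
      rw [igBar_mul, ← mul_assoc, ht])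
    refine (seeded_iff_of_igBar_eq (u := w * t * w) ?_).1 ?_
    · rw [igBar_mul, igBar_mul, ht]
    · rw [wordList_mul]
      refine hs.append_right (c := listBar (wordList t)) ?_
      simp only [listBar_wordList, ← WithOne.coe_mul]
      rw [igBar_mul, ht]
  · rintro ⟨x, s, y, hw, ⟨a, ha⟩, c, hc⟩
    have key : listBar (wordList w) * (c * letterBar s * a) * listBar (wordList w) =
        listBar (wordList w) := by
      rw [hw]
      calc _ = listBar x * (letterBar s * listBar y * c) * letterBar s *
              (a * listBar x * letterBar s) * listBar y := by simp [mul_assoc]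
        _ = listBar x * (letterBar s * letterBar s) * letterBar s * listBar y := by
            rw [ha, hc]; simp only [mul_assoc]
        _ = _ := by
            rw [letterBar_mul_self, mul_assoc (listBar x), letterBar_mul_self]
            simp [mul_assoc]
    exact (isRegularElem_iff_exists w).2 ⟨_, key⟩

lemma RightEquiv.symm {M : Type*} [Monoid M] {a b : M} (h : RightEquiv a b) : RightEquiv b a :=
  ⟨h.2, h.1⟩

lemma LeftEquiv.symm {M : Type*} [Monoid M] {a b : M} (h : LeftEquiv a b) : LeftEquiv b a :=
  ⟨h.2, h.1⟩

lemma RightEquiv.refl {M : Type*} [Monoid M] (a : M) : RightEquiv a a :=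
  ⟨⟨1, mul_one a⟩, 1, mul_one a⟩

lemma RightEquiv.mul_left {M : Type*} [Monoid M] {a b : M} (h : RightEquiv a b) (c : M) :
    RightEquiv (c * a) (c * b) := by
  obtain ⟨⟨x, rfl⟩, y, hy⟩ := h
  exact ⟨⟨x, mul_assoc _ _ _⟩, y, by rw [mul_assoc, hy]⟩

lemma LeftEquiv.mul_right {M : Type*} [Monoid M] {a b : M} (h : LeftEquiv a b) (c : M) :
    LeftEquiv (a * c) (b * c) := by
  obtain ⟨⟨x, rfl⟩, y, hy⟩ := h
  exact ⟨⟨x, (mul_assoc _ _ _).symm⟩, y, by rw [← mul_assoc, hy]⟩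

lemma IsRegularElem.of_rightEquiv_or_leftEquiv {u v : FreeSemigroup (IdemE S)}
    (hu : IsRegularElem (igBar u))
    (h : RightEquiv (listBar (wordList u)) (listBar (wordList v)) ∨
      LeftEquiv (listBar (wordList u)) (listBar (wordList v))) : IsRegularElem (igBar v) := by
  rw [isRegularElem_iff_exists] at hu ⊢
  obtain ⟨d, hd⟩ := hu
  rcases h with ⟨⟨x, hx⟩, y, hy⟩ | ⟨⟨x, hx⟩, y, hy⟩
  · refine ⟨y * d, ?_⟩
    rw [← mul_assoc, hy, ← hx, ← mul_assoc, hd]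
  · refine ⟨d * y, ?_⟩
    rw [mul_assoc, mul_assoc, hy, ← hx, mul_assoc, ← mul_assoc _ d, hd]

lemma greenR_of_rightEquiv {u v : FreeSemigroup (IdemE S)}
    (h : RightEquiv (listBar (wordList u)) (listBar (wordList v))) :
    GreenR (igBar u) (igBar v) := by
  rw [listBar_wordList, listBar_wordList] at h
  obtain ⟨⟨x, hx⟩, y, hy⟩ := h
  cases x with
  | one => exact Or.inl (by simpa using hx)
  | coe x =>
    cases y with
    | one => exact Or.inl (by simpa using hy.symm)
    | coe y => exact Or.inr ⟨x, y, by exact_mod_cast hx, by exact_mod_cast hy⟩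

lemma greenL_of_leftEquiv {u v : FreeSemigroup (IdemE S)}
    (h : LeftEquiv (listBar (wordList u)) (listBar (wordList v))) :
    GreenL (igBar u) (igBar v) := by
  rw [listBar_wordList, listBar_wordList] at h
  obtain ⟨⟨x, hx⟩, y, hy⟩ := h
  cases x with
  | one => exact Or.inl (by simpa using hx)
  | coe x =>
    cases y with
    | one => exact Or.inl (by simpa using hy.symm)
    | coe y => exact Or.inr ⟨x, y, by exact_mod_cast hx, by exact_mod_cast hy⟩

lemma blockProd_congr {T : Type*} [Semigroup T] {F G : ℕ → T} {a k : ℕ}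
    (h : ∀ j, a ≤ j → j ≤ a + k → F j = G j) : blockProd F a k = blockProd G a k := by
  induction k with
  | zero => exact h a le_rfl le_rfl
  | succ k ih =>
    rw [blockProd, blockProd, ih fun j h1 h2 => h j h1 (by omega), h _ (by omega) le_rfl]

lemma listBar_blockProd (p : ℕ → FreeSemigroup (IdemE S)) (a k : ℕ) :
    listBar (wordList (blockProd p a k)) = blockProd (fun j => listBar (wordList (p j))) a k := by
  induction k with
  | zero => rfl
  | succ k ih => simp [blockProd, ih]

lemma blockProd_rightEquiv_or_leftEquiv {M : Type*} [Monoid M] {F G : ℕ → M} {i : ℕ}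
    (hoff : ∀ j, j ≠ i → j ≠ i + 1 → F j = G j) (hmul : F i * F (i + 1) = G i * G (i + 1))
    (hR : RightEquiv (F i) (G i)) (hL : LeftEquiv (F (i + 1)) (G (i + 1))) (a k : ℕ) :
    (a + k = i → RightEquiv (blockProd F a k) (blockProd G a k)) ∧
    (a = i + 1 → LeftEquiv (blockProd F a k) (blockProd G a k)) ∧
    (a + k ≠ i → a ≠ i + 1 → blockProd F a k = blockProd G a k) := by
  induction k with
  | zero =>
    refine ⟨?_, ?_, fun h1 h2 => hoff a h1 h2⟩
    · rintro rfl; exact hR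
    · rintro rfl; exact hL
  | succ k ih =>
    simp only [blockProd]
    refine ⟨?_, ?_, ?_⟩
    · rintro rfl
      rw [blockProd_congr (G := G) fun j _ h => hoff j (by omega) (by omega)]
      exact hR.mul_left _
    · rintro rfl
      rw [hoff (i + 1 + (k + 1)) (by omega) (by omega)]
      exact (ih.2.1 rfl).mul_right _
    · intro h1 h2
      by_cases h : a + k = i
      · subst h
        cases k with
        | zero => exact hmul
        | succ k =>
          simp only [blockProd]
          rw [blockProd_congr (G := G) fun j _ h => hoff j (by omega) (by omega)]
          simp only [mul_assoc]
          exact congrArg _ hmul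
      · rw [ih.2.2 h h2, hoff _ h1 (by omega)]

lemma isMinRFact_of_rightEquiv_or_leftEquiv {w w' : FreeSemigroup (IdemE S)} {m : ℕ}
    {p p' : ℕ → FreeSemigroup (IdemE S)} (hp : IsMinRFact w m p)
    (hw' : blockProd p' 1 (m - 1) = w')
    (h : ∀ a k, RightEquiv (listBar (wordList (blockProd p a k)))
        (listBar (wordList (blockProd p' a k))) ∨
      LeftEquiv (listBar (wordList (blockProd p a k)))
        (listBar (wordList (blockProd p' a k)))) :
    IsMinRFact w' m p' ∧ ∀ i, 1 ≤ i → i ≤ m →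
      (GreenR (igBar (p i)) (igBar (p' i)) ∨ GreenL (igBar (p i)) (igBar (p' i))) ∧
        GreenD (igBar (p i)) (igBar (p' i)) := by
  refine ⟨⟨⟨hp.1.1, hw', fun i h1 h2 => ?_⟩, fun i j h1 h2 h3 hr => ?_⟩, fun i _ _ => ?_⟩
  · exact (hp.1.2.2 i h1 h2).of_rightEquiv_or_leftEquiv (h i 0)
  · exact hp.2 i j h1 h2 h3 (hr.of_rightEquiv_or_leftEquiv
      ((h i (j - i)).imp RightEquiv.symm LeftEquiv.symm))
  · rcases h i 0 with h | h
    · exact ⟨Or.inl (greenR_of_rightEquiv h), _, greenR_of_rightEquiv h, Or.inl rfl⟩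
    · exact ⟨Or.inr (greenL_of_leftEquiv h), _, Or.inl rfl, greenL_of_leftEquiv h⟩

lemma wordList_blockProd (p : ℕ → FreeSemigroup (IdemE S)) (i k : ℕ) :
    wordList (blockProd p i k) =
      ((List.range' i (k + 1)).map fun j => wordList (p j)).flatten := by
  induction k with
  | zero => simp [blockProd]
  | succ k ih => rw [blockProd, wordList_mul, ih, List.range'_1_concat (n := k + 1)]; simp

lemma map_range'_eq_append_cons {α : Type*} {f : ℕ → α} {i n : ℕ} {L₁ L₂ : List α} {x : α}
    (h : (List.range' i n).map f = L₁ ++ x :: L₂) :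
    ∃ k n', n = k + 1 + n' ∧ L₁ = (List.range' i k).map f ∧ x = f (i + k) ∧
      L₂ = (List.range' (i + k + 1) n').map f := by
  obtain ⟨A, B, hAB, rfl, hB⟩ := List.map_eq_append_iff.1 h
  obtain ⟨b, B, rfl, rfl, rfl⟩ := List.map_eq_cons_iff.1 hB
  obtain ⟨k, hk, rfl, hB'⟩ := List.range'_eq_append_iff.1 hAB
  obtain ⟨rfl, hpos, rfl⟩ := List.range'_eq_cons_iff.1 hB'.symm
  exact ⟨k, n - k - 1, by omega, by simp, by simp, by simp⟩

lemma map_range'_congr {α : Type*} {f g : ℕ → α} {i n : ℕ}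
    (h : ∀ j, i ≤ j → j < i + n → f j = g j) :
    (List.range' i n).map f = (List.range' i n).map g :=
  List.map_congr_left fun j hj => by
    rw [List.mem_range'_1] at hj
    exact h j hj.1 hj.2

lemma range'_add_succ_add (i k n : ℕ) :
    List.range' i (k + 1 + n) = List.range' i k ++ (i + k) :: List.range' (i + k + 1) n := by
  rw [← List.range'_append_1 (s := i) (m := k + 1) (n := n), List.range'_1_concat]
  simp [add_assoc]

/-- `w'` has a minimal r-factorisation of length `m` that is related to `p` by ≈ and by Green's
relations. -/
def HasCompatibleFact (w' : FreeSemigroup (IdemE S)) (m : ℕ)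
    (p : ℕ → FreeSemigroup (IdemE S)) : Prop :=
  ∃ p' : ℕ → FreeSemigroup (IdemE S),
    IsMinRFact w' m p' ∧ TupleApprox m p p' ∧
    (∀ i, 1 ≤ i → i ≤ m →
      (GreenR (igBar (p i)) (igBar (p' i)) ∨ GreenL (igBar (p i)) (igBar (p' i))) ∧
      GreenD (igBar (p i)) (igBar (p' i))) ∧
    GreenR (igBar (p 1)) (igBar (p' 1)) ∧ GreenL (igBar (p m)) (igBar (p' m))

lemma hasCompatibleFact_of_replace {w w' : FreeSemigroup (IdemE S)} {m : ℕ}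
    {p : ℕ → FreeSemigroup (IdemE S)} (hp : IsMinRFact w m p)
    {L₁ L₂ : List (List (IdemE S))} {b b' : List (IdemE S)}
    (h : (List.range' 1 m).map (fun j => wordList (p j)) = L₁ ++ b :: L₂) (hb' : b' ≠ [])
    (hbar : listBar b = listBar b') (hw' : wordList w' = L₁.flatten ++ b' ++ L₂.flatten) :
    HasCompatibleFact w' m p := by
  obtain ⟨k, n, rfl, rfl, rfl, rfl⟩ := map_range'_eq_append_cons h
  obtain ⟨t, rfl⟩ := exists_wordList_eq hb'
  have hbar' : ∀ j, listBar (wordList (p j)) =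
      listBar (wordList (Function.update p (1 + k) t j)) := by
    intro j
    rcases eq_or_ne j (1 + k) with rfl | hj
    · rw [Function.update_self, hbar]
    · rw [Function.update_of_ne hj]
  have hblock : blockProd (Function.update p (1 + k) t) 1 (k + 1 + n - 1) = w' := by
    apply wordList_injective
    rw [hw', wordList_blockProd, show k + 1 + n - 1 + 1 = k + 1 + n by omega,
      range'_add_succ_add, List.map_append, List.map_cons, Function.update_self,
      map_range'_congr (i := 1) (g := fun j => wordList (p j)),
      map_range'_congr (i := 1 + k + 1) (g := fun j => wordList (p j))]
    · simp
    · intro j h1 h2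
      rw [Function.update_of_ne (by omega)]
    · intro j h1 h2
      rw [Function.update_of_ne (by omega)]
  obtain ⟨h1, h2⟩ := isMinRFact_of_rightEquiv_or_leftEquiv hp hblock (by
    intro a k
    left
    rw [listBar_blockProd, listBar_blockProd, blockProd_congr fun j _ _ => hbar' j]
    exact RightEquiv.refl _)
  refine ⟨_, h1, Or.inl ⟨1 + k, by omega, by omega, (igBar_eq_iff _ _).2 (hbar' _), ?_⟩, h2,
    Or.inl ((igBar_eq_iff _ _).2 (hbar' _)), Or.inl ((igBar_eq_iff _ _).2 (hbar' _))⟩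
  intro j _ _ hj
  rw [Function.update_of_ne hj]

lemma hasCompatibleFact_of_boundary {w w' : FreeSemigroup (IdemE S)} {m : ℕ}
    {p : ℕ → FreeSemigroup (IdemE S)} (hp : IsMinRFact w m p)
    {L₁ L₂ : List (List (IdemE S))} {u v : List (IdemE S)} {e f g : IdemE S}
    (hef : BasicPair e f) (hg : (g : S) = e * f)
    (h : (List.range' 1 m).map (fun j => wordList (p j)) = L₁ ++ (u ++ [e]) :: (f :: v) :: L₂)
    (hw' : wordList w' = L₁.flatten ++ (u ++ g :: v) ++ L₂.flatten) :
    HasCompatibleFact w' m p := by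
  obtain ⟨i, n, rfl, rfl, hpi, hL⟩ := map_range'_eq_append_cons h
  obtain ⟨i', n, rfl, hi', hpj, rfl⟩ := map_range'_eq_append_cons (L₁ := []) hL.symm
  obtain rfl : i' = 0 := by simpa using hi'.symm
  simp only [Nat.add_zero, Nat.zero_add] at *
  obtain ⟨-, -, hreg⟩ := hp.1
  have hm := letterBar_mul hef hg
  have build : ∀ {a b : List (IdemE S)}, Seeded a → Seeded b → a ++ b = u ++ g :: v →
      RightEquiv (listBar (u ++ [e])) (listBar a) → LeftEquiv (listBar (f :: v)) (listBar b) →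
      (listBar (u ++ [e]) = listBar a * letterBar e ∧
          listBar b = letterBar e * listBar (f :: v) ∨
        listBar a = listBar (u ++ [e]) * letterBar f ∧
          listBar (f :: v) = letterBar f * listBar b) →
      HasCompatibleFact w' (i + 1 + (1 + n)) p := by
    intro a b ha hb hab hRight hLeft happ
    obtain ⟨s, rfl⟩ := exists_wordList_eq ha.ne_nil
    obtain ⟨t, rfl⟩ := exists_wordList_eq hb.ne_nil
    set q : ℕ → FreeSemigroup (IdemE S) :=
      Function.update (Function.update p (1 + i) s) (1 + i + 1) t with hq
    have hq1 : q (1 + i) = s := by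
      rw [hq, Function.update_of_ne (by omega), Function.update_self]
    have hq2 : q (1 + i + 1) = t := Function.update_self ..
    have hq3 : ∀ j, j ≠ 1 + i → j ≠ 1 + i + 1 → p j = q j := by
      intro j h1 h2
      rw [hq, Function.update_of_ne h2, Function.update_of_ne h1]
    have hblock : blockProd q 1 (i + 1 + (1 + n) - 1) = w' := by
      apply wordList_injective
      rw [hw', wordList_blockProd, show i + 1 + (1 + n) - 1 + 1 = i + 1 + (1 + n) by omega,
        range'_add_succ_add, Nat.add_comm 1 n, List.range'_succ, List.map_append, List.map_cons,
        List.map_cons, hq1, hq2,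
        map_range'_congr (i := 1) (f := fun j => wordList (q j)) (g := fun j => wordList (p j)),
        map_range'_congr (i := 1 + i + 1 + 1) (g := fun j => wordList (p j)), ← hab]
      · simp
      · intro j h1 h2
        rw [hq3 j (by omega) (by omega)]
      · intro j h1 h2
        rw [hq3 j (by omega) (by omega)]
    rw [hpi, ← hq1] at hRight
    rw [hpj, ← hq2] at hLeft
    have hrel := blockProd_rightEquiv_or_leftEquiv (F := fun j => listBar (wordList (p j)))
      (G := fun j => listBar (wordList (q j))) (i := 1 + i)
      (fun j h1 h2 => by rw [hq3 j h1 h2]) (by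
        rw [hq1, hq2, ← listBar_append (wordList s), hab, ← hpi, ← hpj]
        simp [← hm, mul_assoc]) hRight hLeft
    obtain ⟨h1, h2⟩ := isMinRFact_of_rightEquiv_or_leftEquiv hp hblock (by
      intro a k
      rw [listBar_blockProd, listBar_blockProd]
      obtain ⟨r1, r2, r3⟩ := hrel a k
      by_cases h : a + k = 1 + i
      · exact Or.inl (r1 h)
      · by_cases h' : a = 1 + i + 1
        · exact Or.inr (r2 h')
        · rw [r3 h h']
          exact Or.inl (RightEquiv.refl _))
    refine ⟨q, h1, Or.inr ?_, h2, ?_, ?_⟩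
    · refine happ.imp (fun happ => ⟨1 + i, e, by omega, by omega, ?_, ?_,
        fun j _ _ h1 h2 => hq3 j h1 h2⟩) (fun happ => ⟨1 + i, f, by omega, by omega, ?_, ?_,
        fun j _ _ h1 h2 => hq3 j h1 h2⟩) <;> rw [igBar_eq_iff, wordList_mul, listBar_append]
      · simpa [← hpi, hq1] using happ.1
      · simpa [← hpj, hq2] using happ.2
      · simpa [← hpi, hq1] using happ.1
      · simpa [← hpj, hq2] using happ.2
    · rcases eq_or_ne i 0 with rfl | hi
      · exact greenR_of_rightEquiv hRight
      · exact Or.inl (by rw [hq3 1 (by omega) (by omega)])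
    · rcases eq_or_ne n 0 with rfl | hn
      · rw [show i + 1 + (1 + 0) = 1 + i + 1 by omega]
        exact greenL_of_leftEquiv hLeft
      · exact Or.inl (by rw [hq3 _ (by omega) (by omega)])
  have hu := (isRegularElem_iff_seeded _).1 (hreg (1 + i) (by omega) (by omega))
  have hv := (isRegularElem_iff_seeded _).1 (hreg (1 + i + 1) (by omega) (by omega))
  rw [← hpi] at hu
  rw [← hpj] at hv
  rcases seeded_boundary hef hg hu hv with hs | ⟨h1, h2, h3, h4⟩ | ⟨h1, h2, h3, h4⟩
  · refine absurd ((isRegularElem_iff_seeded _).2 ?_)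
      (hp.2 (1 + i) (1 + i + 1) (by omega) (by omega) (by omega))
    rw [Nat.add_sub_cancel_left, blockProd, blockProd, wordList_mul, ← hpi, Nat.zero_add, ← hpj]
    simpa using hs
  · refine build h2 h1 (by simp) h3 h4 (Or.inr ⟨?_, by simp⟩)
    simp [mul_assoc, hm]
  · refine build h1 h2 rfl h3 h4 (Or.inl ⟨by simp, ?_⟩)
    simp [← mul_assoc, hm]

lemma wordList_withCtx (u v : Option (FreeSemigroup (IdemE S))) :
    ∃ a b, ∀ x, wordList (withCtx u x v) = a ++ wordList x ++ b := by
  rcases u with _ | u <;> rcases v with _ | v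
  · exact ⟨[], [], fun x => by simp [withCtx]⟩
  · exact ⟨[], wordList v, fun x => by simp [withCtx]⟩
  · exact ⟨wordList u, [], fun x => by simp [withCtx]⟩
  · exact ⟨wordList u, wordList v, fun x => by simp [withCtx]⟩

end Words

theorem stmt2 {S : Type*} [Semigroup S] [Finite (IdemE S)]
    (w w' : FreeSemigroup (IdemE S)) (m : ℕ) (p : ℕ → FreeSemigroup (IdemE S))
    (hp : IsMinRFact w m p) (hww' : RewriteStep w w') :
    ∃ p' : ℕ → FreeSemigroup (IdemE S),
      IsMinRFact w' m p' ∧ TupleApprox m p p' ∧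
      (∀ i, 1 ≤ i → i ≤ m →
        (GreenR (igBar (p i)) (igBar (p' i)) ∨ GreenL (igBar (p i)) (igBar (p' i))) ∧
        GreenD (igBar (p i)) (igBar (p' i))) ∧
      GreenR (igBar (p 1)) (igBar (p' 1)) ∧ GreenL (igBar (p m)) (igBar (p' m)) := by
  change HasCompatibleFact w' m p
  obtain ⟨u, v, x, y, hxy, hw, rfl⟩ := hww'
  obtain ⟨a, b, hab⟩ := wordList_withCtx u v
  have hpw : ((List.range' 1 m).map fun j => wordList (p j)).flatten = a ++ wordList x ++ b := by
    rw [← hab, ← hw, ← hp.1.2.1, wordList_blockProd, Nat.sub_add_cancel hp.1.1]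
  rcases hxy with ⟨e, f, g, hef, hg, rfl, rfl⟩ | ⟨e, f, g, hef, hg, rfl, rfl⟩ <;>
    simp only [wordList_mul, wordList_of, List.append_assoc, List.cons_append,
      List.nil_append] at hpw
  · have hne : ∀ l ∈ (List.range' 1 m).map fun j => wordList (p j), l ≠ [] := by
      simp only [List.mem_map]
      rintro _ ⟨j, -, rfl⟩
      exact wordList_ne_nil _
    rcases flatten_eq_append_cons_cons hne hpw with
      ⟨L₁, u₁, v₁, L₂, hL, rfl, rfl⟩ | ⟨L₁, u₁, v₁, L₂, hL, rfl, rfl⟩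
    · refine hasCompatibleFact_of_replace hp (b' := u₁ ++ g :: v₁) hL (by simp) ?_
        (by rw [hab]; simp)
      simp [← letterBar_mul hef hg, mul_assoc]
    · exact hasCompatibleFact_of_boundary hp hef hg hL (by rw [hab]; simp)
  · obtain ⟨L₁, u₁, v₁, L₂, hL, rfl, rfl⟩ := flatten_eq_append_cons hpw
    refine hasCompatibleFact_of_replace hp (b' := u₁ ++ e :: f :: v₁) hL (by simp) ?_
      (by rw [hab]; simp)
    simp [← letterBar_mul hef hg, mul_assoc]
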